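/- Any two regular spreads of PG(3,q) are projectively equivalent: if S1 and S2 are regular spreads of PG(3,q), then there exists an invertible linear map g of GF(q)^4 such that S2 = { g(ℓ) : ℓ ∈ S1 }, where g(ℓ) denotes the image subspace of the line ℓ under g. -/

import Mathlib

/-- A line of PG(3,q): a 2-dimensional subspace of GF(q)^4. -/
def IsLine (F : Type*) [Field F] (l : Submodule F (Fin 4 → F)) : Prop :=
  Module.finrank F l = 2

/-- Two lines meet if their intersection is nonzero. -/
def Meets {F : Type*} [Field F] (m l : Submodule F (Fin 4 → F)) : Prop :=
  m ⊓ l ≠ ⊥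

/-- A regulus of PG(3,q): a set of q+1 mutually skew lines such that any line of
PG(3,q) meeting three of them meets them all. -/
def IsRegulus (q : ℕ) {F : Type*} [Field F] (R : Set (Submodule F (Fin 4 → F))) : Prop :=
  R.ncard = q + 1 ∧
  (∀ l ∈ R, IsLine F l) ∧
  (∀ l₁ ∈ R, ∀ l₂ ∈ R, l₁ ≠ l₂ → l₁ ⊓ l₂ = ⊥) ∧
  (∀ m : Submodule F (Fin 4 → F), IsLine F m →
    (∃ l₁ ∈ R, ∃ l₂ ∈ R, ∃ l₃ ∈ R, l₁ ≠ l₂ ∧ l₁ ≠ l₃ ∧ l₂ ≠ l₃ ∧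
      Meets m l₁ ∧ Meets m l₂ ∧ Meets m l₃) →
    ∀ l ∈ R, Meets m l)

/-- A spread of PG(3,q): a set of q²+1 mutually skew lines. -/
def IsSpread (q : ℕ) {F : Type*} [Field F] (S : Set (Submodule F (Fin 4 → F))) : Prop :=
  S.ncard = q ^ 2 + 1 ∧
  (∀ l ∈ S, IsLine F l) ∧
  (∀ l₁ ∈ S, ∀ l₂ ∈ S, l₁ ≠ l₂ → l₁ ⊓ l₂ = ⊥)

/-- A spread is regular (Desarguesian) if for any three distinct lines of the
spread, the regulus containing them is contained in the spread. -/
def IsRegularSpread (q : ℕ) {F : Type*} [Field F]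
    (S : Set (Submodule F (Fin 4 → F))) : Prop :=
  IsSpread q S ∧
  ∀ l₁ ∈ S, ∀ l₂ ∈ S, ∀ l₃ ∈ S, l₁ ≠ l₂ → l₁ ≠ l₃ → l₂ ≠ l₃ →
    ∀ R : Set (Submodule F (Fin 4 → F)),
      IsRegulus q R → l₁ ∈ R → l₂ ∈ R → l₃ ∈ R → R ⊆ S


open Module

/-- The vertical line `{0} × W` of `W × W`. -/
def verticalLine (F W : Type*) [Field F] [AddCommGroup W] [Module F W] : Submodule F (W × W) :=
  Submodule.prod ⊥ ⊤

section

variable {F : Type*} [Field F]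

theorem Submodule.exists_eq_graph_of_finrank_eq {H I : Type*} [AddCommGroup H] [Module F H]
    [AddCommGroup I] [Module F I] [FiniteDimensional F H] [FiniteDimensional F I]
    (G : Submodule F (H × I)) (hG : finrank F G = finrank F H)
    (h : ∀ i : I, ((0 : H), i) ∈ G → i = 0) : ∃ f : H →ₗ[F] I, G = f.graph := by
  apply Submodule.exists_eq_graph
  have hinj : Function.Injective (LinearMap.fst F H I ∘ₗ G.subtype) := by
    rw [injective_iff_map_eq_zero]
    rintro ⟨⟨a, b⟩, hab⟩ h0
    have h0 : a = 0 := h0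
    subst h0
    simp [h b hab]
  exact ⟨hinj, (LinearMap.injective_iff_surjective_of_finrank_eq_finrank hG).1 hinj⟩

theorem LinearMap.finrank_graph {H I : Type*} [AddCommGroup H] [Module F H]
    [AddCommGroup I] [Module F I] (f : H →ₗ[F] I) : finrank F f.graph = finrank F H := by
  rw [LinearMap.graph_eq_range_prod]
  apply LinearMap.finrank_range_of_inj
  intro a b hab
  exact congrArg Prod.fst hab

theorem LinearMap.graph_injective {H I : Type*} [AddCommGroup H] [Module F H]
    [AddCommGroup I] [Module F I] :
    Function.Injective (LinearMap.graph : (H →ₗ[F] I) → Submodule F (H × I)) := by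
  intro f g h
  ext x
  have : (x, f x) ∈ g.graph := h ▸ (LinearMap.mem_graph_iff f _).2 rfl
  exact (LinearMap.mem_graph_iff g _).1 this

variable {W : Type*} [AddCommGroup W] [Module F W]

theorem graph_ne_verticalLine [Nontrivial W] (M : W →ₗ[F] W) : M.graph ≠ verticalLine F W := by
  intro h
  obtain ⟨v, hv⟩ := exists_ne (0 : W)
  have : (v, M v) ∈ verticalLine F W := h ▸ (LinearMap.mem_graph_iff M _).2 rfl
  exact hv this.1

theorem finrank_verticalLine : finrank F (verticalLine F W) = finrank F W := by
  have : verticalLine F W = LinearMap.range (LinearMap.inr F W W) := by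
    ext ⟨a, b⟩
    simp [verticalLine, eq_comm]
  rw [this]
  exact LinearMap.finrank_range_of_inj LinearMap.inr_injective

/-- If three lines of the pencil `u ↦ u ⊗ W` meet a line `m`, then `m = F² ⊗ x` for some `x`. -/
theorem exists_smul_mem_of_three {m : Submodule F (W × W)} (hm : finrank F m = 2)
    {x₁ x₂ x₃ : W} (hx₁ : x₁ ≠ 0) (hx₂ : x₂ ≠ 0) (hx₃ : x₃ ≠ 0) {u₁ u₂ u₃ : F × F}
    (h₁₂ : u₁.1 * u₂.2 - u₂.1 * u₁.2 ≠ 0) (h₁₃ : u₁.1 * u₃.2 - u₃.1 * u₁.2 ≠ 0)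
    (h₂₃ : u₂.1 * u₃.2 - u₃.1 * u₂.2 ≠ 0)
    (hm₁ : (u₁.1 • x₁, u₁.2 • x₁) ∈ m) (hm₂ : (u₂.1 • x₂, u₂.2 • x₂) ∈ m)
    (hm₃ : (u₃.1 • x₃, u₃.2 • x₃) ∈ m) :
    ∃ x : W, x ≠ 0 ∧ ∀ s t : F, (s • x, t • x) ∈ m := by
  have : FiniteDimensional F m := FiniteDimensional.of_finrank_pos (by omega)
  let w : Fin 3 → m := ![⟨_, hm₁⟩, ⟨_, hm₂⟩, ⟨_, hm₃⟩]
  have hdep : ¬ LinearIndependent F w := by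
    intro h
    have := h.fintype_card_le_finrank
    simp [hm] at this
  rw [Fintype.not_linearIndependent_iff] at hdep
  obtain ⟨c, hc, i, hi⟩ := hdep
  obtain ⟨hc₁, hc₂⟩ : c 0 • u₁.1 • x₁ + c 1 • u₂.1 • x₂ + c 2 • u₃.1 • x₃ = 0 ∧
      c 0 • u₁.2 • x₁ + c 1 • u₂.2 • x₂ + c 2 • u₃.2 • x₃ = 0 := by
    have := congrArg (Subtype.val) hc
    simpa [w, Fin.sum_univ_three, Prod.ext_iff] using this
  have e₁ : (c 0 * (u₁.1 * u₃.2 - u₃.1 * u₁.2)) • x₁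
      + (c 1 * (u₂.1 * u₃.2 - u₃.1 * u₂.2)) • x₂ = 0 := by
    linear_combination (norm := module) u₃.2 • hc₁ - u₃.1 • hc₂
  have e₂ : (c 0 * (u₁.1 * u₂.2 - u₂.1 * u₁.2)) • x₁
      = (c 2 * (u₂.1 * u₃.2 - u₃.1 * u₂.2)) • x₃ := by
    linear_combination (norm := module) u₂.2 • hc₁ - u₂.1 • hc₂
  have hc0 : c 0 ≠ 0 := by
    intro h0
    have h1 : c 1 = 0 := by simpa [h0, hx₂, h₂₃] using e₁
    have h2 : c 2 = 0 := by simpa [h0, hx₃, h₂₃] using e₂.symm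
    fin_cases i <;> simp_all
  obtain ⟨a, rfl⟩ : ∃ a : F, x₁ = a • x₂ := by
    refine ⟨-(c 0 * (u₁.1 * u₃.2 - u₃.1 * u₁.2))⁻¹ * (c 1 * (u₂.1 * u₃.2 - u₃.1 * u₂.2)), ?_⟩
    rw [mul_smul, eq_neg_of_add_eq_zero_right e₁, smul_neg, neg_smul, neg_neg,
      inv_smul_smul₀ (mul_ne_zero hc0 h₁₃)]
  have ha : a ≠ 0 := by rintro rfl; simp at hx₁
  refine ⟨x₂, hx₂, fun s t => ?_⟩
  have k₁ : (u₁.1 • x₂, u₁.2 • x₂) ∈ m := by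
    have := m.smul_mem a⁻¹ hm₁
    simpa [smul_smul, mul_left_comm, ha] using this
  have : ((s • x₂, t • x₂) : W × W) = ((s * u₂.2 - t * u₂.1) / (u₁.1 * u₂.2 - u₂.1 * u₁.2)) •
      (u₁.1 • x₂, u₁.2 • x₂) + ((u₁.1 * t - s * u₁.2) / (u₁.1 * u₂.2 - u₂.1 * u₁.2)) •
      (u₂.1 • x₂, u₂.2 • x₂) := by
    ext <;> simp only [Prod.smul_mk, smul_smul, Prod.mk_add_mk, ← add_smul] <;> congr 1 <;>
      rw [div_mul_eq_mul_div, div_mul_eq_mul_div, ← add_div, eq_div_iff h₁₂] <;> ring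
  rw [this]
  exact m.add_mem (m.smul_mem _ k₁) (m.smul_mem _ hm₂)

theorem meets_map_iff {e : (W × W) ≃ₗ[F] (Fin 4 → F)} {m : Submodule F (Fin 4 → F)}
    {l : Submodule F (W × W)} :
    Meets m (l.map (e : (W × W) →ₗ[F] (Fin 4 → F))) ↔ ∃ p ∈ l, p ≠ 0 ∧ e p ∈ m := by
  rw [Meets, Submodule.ne_bot_iff]
  constructor
  · rintro ⟨_, ⟨hm, p, hp, rfl⟩, h0⟩
    exact ⟨p, hp, by rintro rfl; simp at h0, hm⟩
  · rintro ⟨p, hp, h0, hm⟩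
    exact ⟨e p, ⟨hm, p, hp, rfl⟩, by simpa using h0⟩

theorem map_inf_map_eq_bot_iff {V : Type*} [AddCommGroup V] [Module F V]
    {e : (W × W) ≃ₗ[F] V} {l l' : Submodule F (W × W)} :
    l.map (e : (W × W) →ₗ[F] V) ⊓ l'.map (e : (W × W) →ₗ[F] V) = ⊥ ↔
      ∀ p ∈ l, p ∈ l' → p = 0 := by
  rw [← Submodule.map_inf _ e.injective, Submodule.eq_bot_iff]
  constructor
  · intro h p hp hp'
    exact e.map_eq_zero_iff.1 (h _ ⟨p, ⟨hp, hp'⟩, rfl⟩)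
  · rintro h _ ⟨p, ⟨hp, hp'⟩, rfl⟩
    simp [h p hp hp']

theorem map_equiv_injective {V : Type*} [AddCommGroup V] [Module F V] (e : (W × W) ≃ₗ[F] V) :
    Function.Injective (Submodule.map (e : (W × W) →ₗ[F] V)) :=
  Submodule.map_injective_of_injective e.injective

theorem isRegulus_scalars [Fintype F] (hW : finrank F W = 2)
    (e : (W × W) ≃ₗ[F] (Fin 4 → F)) :
    IsRegulus (Fintype.card F) (insert ((verticalLine F W).map (e : (W × W) →ₗ[F] (Fin 4 → F)))
      (Set.range fun t : F => (LinearMap.graph (t • (1 : End F W))).map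
        (e : (W × W) →ₗ[F] (Fin 4 → F)))) := by
  have : Nontrivial W := Module.nontrivial_of_finrank_pos (R := F) (by omega)
  have hinj : Function.Injective fun t : F => (LinearMap.graph (t • (1 : End F W))).map
        (e : (W × W) →ₗ[F] (Fin 4 → F)) := by
    intro s t h
    have h := LinearMap.graph_injective (map_equiv_injective e h)
    exact smul_left_injective F one_ne_zero h
  have hparam : ∀ l ∈ insert ((verticalLine F W).map (e : (W × W) →ₗ[F] (Fin 4 → F)))
      (Set.range fun t : F => (LinearMap.graph (t • (1 : End F W))).map
        (e : (W × W) →ₗ[F] (Fin 4 → F))),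
      ∃ (u : F × F) (L : Submodule F (W × W)), l = L.map (e : (W × W) →ₗ[F] (Fin 4 → F)) ∧
        (u = (0, 1) ∨ u.1 = 1) ∧ ∀ p : W × W, p ∈ L ↔ ∃ x, p = (u.1 • x, u.2 • x) := by
    rintro _ (rfl | ⟨t, rfl⟩)
    · exact ⟨(0, 1), _, rfl, .inl rfl, fun p => by simp [verticalLine, Prod.ext_iff]⟩
    · exact ⟨(1, t), _, rfl, .inr rfl, fun p => by
        simp [LinearMap.mem_graph_iff, Prod.ext_iff]⟩
  have hdet : ∀ (u u' : F × F) (L L' : Submodule F (W × W)),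
      (u = (0, 1) ∨ u.1 = 1) → (u' = (0, 1) ∨ u'.1 = 1) →
      (∀ p : W × W, p ∈ L ↔ ∃ x, p = (u.1 • x, u.2 • x)) →
      (∀ p : W × W, p ∈ L' ↔ ∃ x, p = (u'.1 • x, u'.2 • x)) →
      L.map (e : (W × W) →ₗ[F] (Fin 4 → F)) ≠ L'.map (e : (W × W) →ₗ[F] (Fin 4 → F)) →
      u.1 * u'.2 - u'.1 * u.2 ≠ 0 := by
    intro u u' L L' hu hu' hL hL' hne h0
    have : u = u' := by
      obtain ⟨a, b⟩ := u
      obtain ⟨a', b'⟩ := u'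
      rcases hu with hu | hu <;> rcases hu' with hu' | hu' <;> simp_all [sub_eq_zero]
    subst this
    apply hne
    congr 1
    ext p
    rw [hL, hL']
  refine ⟨?_, ?_, ?_, ?_⟩
  · rw [Set.ncard_insert_of_notMem _ (Set.finite_range _), ← Set.image_univ,
      Set.ncard_image_of_injective _ hinj, Set.ncard_univ, Nat.card_eq_fintype_card]
    rintro ⟨t, ht⟩
    exact graph_ne_verticalLine _ (map_equiv_injective e ht)
  · rintro _ (rfl | ⟨t, rfl⟩)
    · exact (LinearEquiv.finrank_map_eq e _).trans (finrank_verticalLine.trans hW)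
    · exact (LinearEquiv.finrank_map_eq e _).trans ((LinearMap.finrank_graph _).trans hW)
  · intro l₁ h₁ l₂ h₂ hne
    obtain ⟨u₁, L₁, rfl, hu₁, hL₁⟩ := hparam _ h₁
    obtain ⟨u₂, L₂, rfl, hu₂, hL₂⟩ := hparam _ h₂
    have hd := hdet _ _ _ _ hu₁ hu₂ hL₁ hL₂ hne
    rw [map_inf_map_eq_bot_iff]
    intro p hp₁ hp₂
    obtain ⟨x, rfl⟩ := (hL₁ p).1 hp₁
    obtain ⟨y, hy⟩ := (hL₂ _).1 hp₂
    obtain ⟨hy₁, hy₂⟩ := Prod.ext_iff.1 hy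
    have : (u₁.1 * u₂.2 - u₂.1 * u₁.2) • x = 0 := by
      simp only at hy₁ hy₂
      linear_combination (norm := module) u₂.2 • hy₁ - u₂.1 • hy₂
    have hx : x = 0 := by simpa [hd] using this
    simp [hx]
  · rintro m hm ⟨l₁, h₁, l₂, h₂, l₃, h₃, h₁₂, h₁₃, h₂₃, hm₁, hm₂, hm₃⟩ l hl
    obtain ⟨u₁, L₁, rfl, hu₁, hL₁⟩ := hparam _ h₁
    obtain ⟨u₂, L₂, rfl, hu₂, hL₂⟩ := hparam _ h₂
    obtain ⟨u₃, L₃, rfl, hu₃, hL₃⟩ := hparam _ h₃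
    obtain ⟨u, L, rfl, hu, hL⟩ := hparam _ hl
    rw [meets_map_iff] at hm₁ hm₂ hm₃ ⊢
    obtain ⟨p₁, hp₁, hn₁, hm₁⟩ := hm₁
    obtain ⟨p₂, hp₂, hn₂, hm₂⟩ := hm₂
    obtain ⟨p₃, hp₃, hn₃, hm₃⟩ := hm₃
    obtain ⟨x₁, rfl⟩ := (hL₁ _).1 hp₁
    obtain ⟨x₂, rfl⟩ := (hL₂ _).1 hp₂
    obtain ⟨x₃, rfl⟩ := (hL₃ _).1 hp₃
    have hm' : finrank F (m.comap (e : (W × W) →ₗ[F] (Fin 4 → F))) = 2 := by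
      rw [Submodule.comap_equiv_eq_map_symm]
      exact (LinearEquiv.finrank_map_eq e.symm m).trans hm
    obtain ⟨x, hx, hxm⟩ := exists_smul_mem_of_three hm' (x₁ := x₁) (x₂ := x₂) (x₃ := x₃)
      (by rintro rfl; simp at hn₁) (by rintro rfl; simp at hn₂) (by rintro rfl; simp at hn₃)
      (hdet _ _ _ _ hu₁ hu₂ hL₁ hL₂ h₁₂) (hdet _ _ _ _ hu₁ hu₃ hL₁ hL₃ h₁₃)
      (hdet _ _ _ _ hu₂ hu₃ hL₂ hL₃ h₂₃) hm₁ hm₂ hm₃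
    refine ⟨_, (hL _).2 ⟨x, rfl⟩, ?_, hxm _ _⟩
    rcases hu with rfl | hu
    · simp [hx]
    · simp [hu, hx]

theorem exists_coordinates {l₀ l₁ lv : Submodule F (Fin 4 → F)} (h₀ : IsLine F l₀)
    (h₁ : IsLine F l₁) (hv : IsLine F lv) (h₀₁ : l₀ ⊓ l₁ = ⊥) (h₀v : l₀ ⊓ lv = ⊥)
    (h₁v : l₁ ⊓ lv = ⊥) :
    ∃ e : (l₀ × l₀) ≃ₗ[F] (Fin 4 → F),
      (verticalLine F l₀).map (e : (l₀ × l₀) →ₗ[F] (Fin 4 → F)) = lv ∧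
      (LinearMap.graph (0 : End F l₀)).map (e : (l₀ × l₀) →ₗ[F] (Fin 4 → F)) = l₀ ∧
      (LinearMap.graph (1 : End F l₀)).map (e : (l₀ × l₀) →ₗ[F] (Fin 4 → F)) = l₁ := by
  unfold IsLine at h₀ h₁ hv
  have hc : IsCompl l₀ lv :=
    (Submodule.isCompl_iff_disjoint _ _ (by simp [h₀, hv])).2 (disjoint_iff.2 h₀v)
  let p := Submodule.prodEquivOfIsCompl l₀ lv hc
  obtain ⟨f, hf⟩ := Submodule.exists_eq_graph_of_finrank_eq
    (l₁.comap (p : (l₀ × lv) →ₗ[F] (Fin 4 → F))) (by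
      rw [Submodule.comap_equiv_eq_map_symm, h₀]
      exact (LinearEquiv.finrank_map_eq p.symm l₁).trans h₁) (by
      intro i hi
      have hi : ((0 : l₀) : Fin 4 → F) + i ∈ l₁ := hi
      have : (i : Fin 4 → F) ∈ l₁ ⊓ lv := ⟨by simpa using hi, i.2⟩
      rw [h₁v] at this
      simpa using this)
  have hf' : ∀ (x : l₀) (y : lv), (x + y : Fin 4 → F) ∈ l₁ ↔ y = f x := fun x y => by
    rw [← LinearMap.mem_graph_iff f (x, y), ← hf]
    rfl
  have hinj : Function.Injective f := by
    rw [injective_iff_map_eq_zero]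
    intro x hx
    have : (x : Fin 4 → F) ∈ l₀ ⊓ l₁ := ⟨x.2, by simpa [hx] using hf' x 0⟩
    rw [h₀₁] at this
    simpa using this
  let g : l₀ ≃ₗ[F] lv := LinearEquiv.ofInjectiveOfFinrankEq f hinj (h₀.trans hv.symm)
  have hg : ∀ x, g x = f x := fun x => rfl
  let e : (l₀ × l₀) ≃ₗ[F] (Fin 4 → F) := ((LinearEquiv.refl F l₀).prodCongr g).trans p
  have he : ∀ x y : l₀, e (x, y) = x + g y := fun x y => rfl
  refine ⟨e, ?_, ?_, ?_⟩
  · ext v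
    constructor
    · rintro ⟨⟨x, y⟩, hx, rfl⟩
      have hx : x = 0 := hx.1
      subst hx
      simp [he]
    · intro h
      exact ⟨(0, g.symm ⟨v, h⟩), by simp [verticalLine], by simp [he]⟩
  · ext v
    constructor
    · rintro ⟨⟨x, y⟩, hx, rfl⟩
      have hx : y = 0 := hx
      subst hx
      simp [he]
    · intro h
      exact ⟨(⟨v, h⟩, 0), by simp [LinearMap.mem_graph_iff], by simp [he]⟩
  · ext v
    constructor
    · rintro ⟨⟨x, y⟩, hx, rfl⟩
      have hx : y = x := hx
      subst hx
      exact (hf' y (g y)).2 (hg y)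
    · intro h
      obtain ⟨⟨x, y⟩, rfl⟩ := p.surjective v
      refine ⟨(x, x), rfl, ?_⟩
      have := (hf' x y).1 h
      subst this
      rfl

theorem exists_map_graph_eq (hW : finrank F W = 2) {e : (W × W) ≃ₗ[F] (Fin 4 → F)}
    {l : Submodule F (Fin 4 → F)} (hl : IsLine F l)
    (h : (verticalLine F W).map (e : (W × W) →ₗ[F] (Fin 4 → F)) ⊓ l = ⊥) :
    ∃ M : End F W, M.graph.map (e : (W × W) →ₗ[F] (Fin 4 → F)) = l := by
  have : FiniteDimensional F W := FiniteDimensional.of_finrank_pos (by omega)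
  have hl' : (l.comap (e : (W × W) →ₗ[F] (Fin 4 → F))).map (e : (W × W) →ₗ[F] (Fin 4 → F)) = l :=
    Submodule.map_comap_eq_of_surjective e.surjective l
  obtain ⟨M, hM⟩ := Submodule.exists_eq_graph_of_finrank_eq
    (l.comap (e : (W × W) →ₗ[F] (Fin 4 → F))) (by
      rw [Submodule.comap_equiv_eq_map_symm, hW]
      exact (LinearEquiv.finrank_map_eq e.symm l).trans hl) (by
      intro i hi
      rw [← hl', map_inf_map_eq_bot_iff] at h
      exact congrArg Prod.snd (h (0, i) (by simp [verticalLine]) hi))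
  exact ⟨M, by rw [← hM, hl']⟩

theorem isRegulus_affine [Fintype F] (hW : finrank F W = 2) (e : (W × W) ≃ₗ[F] (Fin 4 → F))
    (M D : End F W) (hD : Function.Injective D) :
    IsRegulus (Fintype.card F) (insert ((verticalLine F W).map (e : (W × W) →ₗ[F] (Fin 4 → F)))
      (Set.range fun t : F => (LinearMap.graph (M + t • D)).map
        (e : (W × W) →ₗ[F] (Fin 4 → F)))) := by
  have : FiniteDimensional F W := FiniteDimensional.of_finrank_pos (by omega)
  let d : W ≃ₗ[F] W := LinearEquiv.ofInjectiveOfFinrankEq D hD rfl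
  have hd : ∀ x, d x = D x := fun x => rfl
  let s : (W × W) ≃ₗ[F] (W × W) := (LinearEquiv.refl F W).skewProd d M
  have hs : ∀ x y, s (x, y) = (x, D y + M x) := fun x y => rfl
  have hv : (verticalLine F W).map (s.trans e : (W × W) →ₗ[F] (Fin 4 → F)) =
      (verticalLine F W).map (e : (W × W) →ₗ[F] (Fin 4 → F)) := by
    rw [LinearEquiv.coe_trans, Submodule.map_comp]
    congr 1
    ext ⟨a, b⟩
    constructor
    · rintro ⟨⟨x, y⟩, hx, h⟩
      have hx : x = 0 := hx.1
      have h : (x, D y + M x) = (a, b) := h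
      simp only [Prod.mk.injEq] at h
      simp [verticalLine, ← h.1, hx]
    · intro h
      have h : a = 0 := h.1
      refine ⟨(0, d.symm b), by simp [verticalLine], ?_⟩
      have : D (d.symm b) = b := d.apply_symm_apply b
      simp [hs, h, this]
  have hg : ∀ t : F, (LinearMap.graph (t • (1 : End F W))).map
      (s.trans e : (W × W) →ₗ[F] (Fin 4 → F)) =
      (LinearMap.graph (M + t • D)).map (e : (W × W) →ₗ[F] (Fin 4 → F)) := by
    intro t
    rw [LinearEquiv.coe_trans, Submodule.map_comp]
    congr 1
    ext ⟨a, b⟩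
    constructor
    · rintro ⟨⟨x, y⟩, hx, h⟩
      have hx : y = t • x := hx
      have h : (x, D y + M x) = (a, b) := h
      simp only [Prod.mk.injEq] at h
      obtain ⟨rfl, rfl⟩ := h
      simp [LinearMap.mem_graph_iff, hx, add_comm]
    · intro h
      have h : b = M a + t • D a := h
      exact ⟨(a, t • a), rfl, by simp [hs, h, add_comm]⟩
  have := isRegulus_scalars hW (s.trans e)
  simpa only [hv, hg] using this
theorem exists_subalgebra_eq (hW : finrank F W = 2) (C : Submodule F (End F W))
    (hC : finrank F C = 2) (h1 : (1 : End F W) ∈ C) :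
    ∃ K : Subalgebra F (End F W), (K : Set (End F W)) = C := by
  have : FiniteDimensional F W := FiniteDimensional.of_finrank_pos (by omega)
  have : FiniteDimensional F C := FiniteDimensional.of_finrank_pos (by omega)
  have : Nontrivial W := Module.nontrivial_of_finrank_pos (R := F) (by omega)
  have hsq : ∀ N ∈ C, N * N ∈ C := by
    intro N hN
    have hdeg : N.charpoly.natDegree = 2 := by rw [LinearMap.charpoly_natDegree, hW]
    have hmon : N.charpoly.coeff 2 = 1 := by
      rw [← hdeg]
      exact N.charpoly_monic
    have h := N.aeval_self_charpoly
    rw [Polynomial.aeval_eq_sum_range, hdeg] at h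
    simp only [Finset.sum_range_succ, Finset.sum_range_zero, hmon, pow_zero, pow_one, one_smul,
      zero_add, pow_two] at h
    rw [eq_neg_of_add_eq_zero_right h]
    exact C.neg_mem (C.add_mem (C.smul_mem _ h1) (C.smul_mem _ hN))
  have hmul : ∀ M ∈ C, ∀ N ∈ C, M * N ∈ C := by
    intro M hM N hN
    by_cases hsc : ∃ c : F, c • (1 : End F W) = N
    · obtain ⟨c, rfl⟩ := hsc
      simpa using C.smul_mem c hM
    · have hli : LinearIndependent F ![(1 : End F W), N] :=
        (LinearIndependent.pair_iff' one_ne_zero).2 fun a ha => hsc ⟨a, ha⟩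
      have hspan : Submodule.span F (Set.range ![(1 : End F W), N]) = C := by
        apply Submodule.eq_of_le_of_finrank_le
        · rw [Submodule.span_le]
          rintro _ ⟨i, rfl⟩
          fin_cases i
          · exact h1
          · exact hN
        · rw [finrank_span_eq_card hli, hC]
          simp
      rw [← hspan] at hM
      simp only [Matrix.range_cons, Matrix.range_empty, Set.union_empty,
        Set.singleton_union] at hM
      obtain ⟨a, b, rfl⟩ := Submodule.mem_span_pair.1 hM
      rw [add_mul, smul_mul_assoc, smul_mul_assoc, one_mul]
      exact C.add_mem (C.smul_mem _ hN) (C.smul_mem _ (hsq N hN))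
  exact ⟨C.toSubalgebra h1 fun M N hM hN => hmul M hM N hN, rfl⟩

theorem exists_submodule_eq [Fintype F] (hW : finrank F W = 2) (C : Set (End F W))
    (hcard : C.ncard = Fintype.card F ^ 2) (h0 : (0 : End F W) ∈ C)
    (hinj : ∀ M ∈ C, ∀ N ∈ C, M ≠ N → Function.Injective (N - M))
    (haff : ∀ M ∈ C, ∀ N ∈ C, ∀ t : F, M + t • (N - M) ∈ C) :
    ∃ P : Submodule F (End F W), (P : Set (End F W)) = C := by
  have : FiniteDimensional F W := FiniteDimensional.of_finrank_pos (by omega)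
  have : Finite W := Module.finite_of_finite F
  have : Nontrivial W := Module.nontrivial_of_finrank_pos (R := F) (by omega)
  have hq : 0 < Fintype.card F := Fintype.card_pos
  have hCfin : C.Finite := Set.finite_of_ncard_pos (by rw [hcard]; positivity)
  have hsmul : ∀ M ∈ C, ∀ t : F, t • M ∈ C := fun M hM t => by
    simpa using haff 0 h0 M hM t
  have hadd : ∀ M ∈ C, ∀ N ∈ C, M + N ∈ C := by
    intro M hM N hN
    by_cases ht : ∃ t : F, t ≠ 0 ∧ t ≠ 1
    · obtain ⟨t, ht0, ht1⟩ := ht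
      have ht1' : 1 - t ≠ 0 := sub_ne_zero.2 ht1.symm
      have := haff _ (hsmul M hM (1 - t)⁻¹) _ (hsmul N hN t⁻¹) t
      convert this using 1
      rw [smul_sub, smul_inv_smul₀ ht0, smul_smul, add_sub, add_sub_right_comm, ← sub_smul,
        ← one_sub_mul, mul_inv_cancel₀ ht1', one_smul]
    · push Not at ht
      have hcard2 : Fintype.card F = 2 := by
        classical
        have : (Finset.univ : Finset F) = {0, 1} := by
          ext t
          by_cases h : t = 0
          · simp [h]
          · simp [ht t h]
        rw [← Finset.card_univ, this, Finset.card_pair zero_ne_one]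
      have h2 : (2 : F) = 0 := by
        have := FiniteField.cast_card_eq_zero F
        rwa [hcard2] at this
      have hneg : ∀ x : W, x + x = 0 := fun x => by
        rw [← two_smul F x, h2, zero_smul]
      by_cases hM0 : M = 0
      · simpa [hM0] using hN
      by_cases hN0 : N = 0
      · simpa [hN0] using hM
      by_cases hMN : M = N
      · subst hMN
        have : M + M = 0 := by ext x; exact hneg (M x)
        rwa [this]
      have hev : ∀ v : W, v ≠ 0 → ∀ A ∈ C, ∀ B ∈ C, A v = B v → A = B := by
        intro v hv A hA B hB h
        by_contra hne
        exact hv (hinj A hA B hB hne (by simp [h]))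
      have hsurj : ∀ v : W, v ≠ 0 → ∀ w : W, ∃ A ∈ C, A v = w := by
        intro v hv w
        have : (fun A : End F W => A v) '' C = Set.univ := by
          apply Set.eq_of_subset_of_ncard_le (Set.subset_univ _)
          rw [Set.InjOn.ncard_image fun A hA B hB h => hev v hv A hA B hB h, hcard,
            Set.ncard_univ, Module.natCard_eq_pow_finrank (K := F), hW,
            Nat.card_eq_fintype_card]
        have hw : w ∈ (fun A : End F W => A v) '' C := this ▸ Set.mem_univ w
        exact hw
      have hfour : (C \ {0, M, N}).ncard = 1 := by
        rw [Set.ncard_sdiff (by rintro _ (rfl | rfl | rfl) <;> assumption), hcard, hcard2,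
          Set.ncard_eq_three.2 ⟨0, M, N, Ne.symm hM0, Ne.symm hN0, hMN, rfl⟩]
        norm_num
      obtain ⟨P, hP⟩ := Set.ncard_eq_one.1 hfour
      have hPC : P ∈ C := (hP ▸ Set.mem_singleton P : P ∈ C \ {0, M, N}).1
      have : M + N = P := by
        ext v
        by_cases hv : v = 0
        · simp [hv]
        obtain ⟨A, hA, hAv⟩ := hsurj v hv (M v + N v)
        have hAP : A ∈ C \ {0, M, N} := by
          refine ⟨hA, ?_⟩
          rintro (rfl | rfl | rfl)
          · refine hMN (hev v hv M hM N hN ?_)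
            rw [eq_neg_of_add_eq_zero_left hAv.symm, neg_eq_of_add_eq_zero_left (hneg _)]
          · exact hN0 (hev v hv N hN 0 h0 (by simpa using hAv))
          · exact hM0 (hev v hv M hM 0 h0 (by simpa using hAv))
        rw [hP] at hAP
        rw [← Set.mem_singleton_iff.1 hAP, hAv]
        rfl
      rwa [this]
  exact ⟨{ carrier := C, add_mem' := fun ha hb => hadd _ ha _ hb, zero_mem' := h0,
           smul_mem' := fun t M hM => hsmul M hM t }, rfl⟩
theorem nonempty_algEquiv_of_finrank_eq {K K' : Type*} [Ring K] [Ring K'] [IsDomain K]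
    [IsDomain K'] [Algebra F K] [Algebra F K'] [Finite K] [Finite K']
    (h : finrank F K = finrank F K') : Nonempty (K ≃ₐ[F] K') := by
  let := (Finite.isDomain_to_isField K).toField
  let := (Finite.isDomain_to_isField K').toField
  obtain ⟨f⟩ := FiniteField.nonempty_algHom_of_finrank_dvd (F := F) (K := K) (L := K') h.dvd
  have : Module.Finite F K := Module.Finite.of_finite
  have : Module.Finite F K' := Module.Finite.of_finite
  have hf : Function.Injective f := f.toRingHom.injective
  exact ⟨AlgEquiv.ofBijective f
    ⟨hf, (LinearMap.injective_iff_surjective_of_finrank_eq_finrank (f := f.toLinearMap) h).1 hf⟩⟩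

theorem IsRegularSpread.exists_subalgebra_of_coordinates [Fintype F]
    {S : Set (Submodule F (Fin 4 → F))} (hS : IsRegularSpread (Fintype.card F) S)
    (hW : finrank F W = 2) (e : (W × W) ≃ₗ[F] (Fin 4 → F))
    (hv : (verticalLine F W).map (e : (W × W) →ₗ[F] (Fin 4 → F)) ∈ S)
    (h₀ : (LinearMap.graph (0 : End F W)).map (e : (W × W) →ₗ[F] (Fin 4 → F)) ∈ S)
    (h₁ : (LinearMap.graph (1 : End F W)).map (e : (W × W) →ₗ[F] (Fin 4 → F)) ∈ S) :
    ∃ K : Subalgebra F (End F W),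
      finrank F K = 2 ∧ (∀ M ∈ K, M ≠ 0 → Function.Injective M) ∧
      S = insert ((verticalLine F W).map (e : (W × W) →ₗ[F] (Fin 4 → F)))
        ((fun M : End F W => M.graph.map (e : (W × W) →ₗ[F] (Fin 4 → F))) '' K) := by
  obtain ⟨⟨hcard, hline, hskew⟩, hreg⟩ := hS
  have hq : 2 ≤ Fintype.card F := Fintype.one_lt_card
  have hfin : S.Finite := Set.finite_of_ncard_pos (by omega)
  have : FiniteDimensional F W := FiniteDimensional.of_finrank_pos (by omega)
  have : Nontrivial W := Module.nontrivial_of_finrank_pos (R := F) (by omega)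
  let γ : End F W → Submodule F (Fin 4 → F) :=
    fun M => M.graph.map (e : (W × W) →ₗ[F] (Fin 4 → F))
  have hγ : Function.Injective γ := fun M N h =>
    LinearMap.graph_injective (map_equiv_injective e h)
  let C : Set (End F W) := {M | γ M ∈ S}
  have hvC : (verticalLine F W).map (e : (W × W) →ₗ[F] (Fin 4 → F)) ∉ γ '' C := by
    rintro ⟨M, -, hM⟩
    exact graph_ne_verticalLine M (map_equiv_injective e hM)
  have hSC : S = insert ((verticalLine F W).map (e : (W × W) →ₗ[F] (Fin 4 → F))) (γ '' C) := by
    ext l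
    constructor
    · intro hl
      by_cases h : l = (verticalLine F W).map (e : (W × W) →ₗ[F] (Fin 4 → F))
      · exact .inl h
      · obtain ⟨M, rfl⟩ := exists_map_graph_eq hW (hline _ hl) (hskew _ hv _ hl (Ne.symm h))
        exact .inr ⟨M, hl, rfl⟩
    · rintro (rfl | ⟨M, hM, rfl⟩)
      · exact hv
      · exact hM
  have hCcard : C.ncard = Fintype.card F ^ 2 := by
    have hCfin : (γ '' C).Finite := hfin.subset (by rintro _ ⟨M, hM, rfl⟩; exact hM)
    rw [hSC, Set.ncard_insert_of_notMem hvC hCfin, Set.ncard_image_of_injective _ hγ] at hcard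
    omega
  have hC0 : (0 : End F W) ∈ C := h₀
  have hC1 : (1 : End F W) ∈ C := h₁
  have hCinj : ∀ M ∈ C, ∀ N ∈ C, M ≠ N → Function.Injective (N - M) := by
    intro M hM N hN hne
    rw [injective_iff_map_eq_zero]
    intro x hx
    have hx : N x - M x = 0 := hx
    have := map_inf_map_eq_bot_iff.1 (hskew _ hM _ hN (hγ.ne hne)) (x, M x) rfl
      (sub_eq_zero.1 hx).symm
    exact congrArg Prod.fst this
  have hCaff : ∀ M ∈ C, ∀ N ∈ C, ∀ t : F, M + t • (N - M) ∈ C := by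
    intro M hM N hN t
    by_cases hne : M = N
    · simpa [hne] using hN
    have hv' : ∀ M ∈ C, (verticalLine F W).map (e : (W × W) →ₗ[F] (Fin 4 → F)) ≠ γ M :=
      fun M hM h => hvC ⟨M, hM, h.symm⟩
    exact hreg _ hv _ hM _ hN (hv' M hM) (hv' N hN) (hγ.ne hne) _
      (isRegulus_affine hW e M (N - M) (hCinj M hM N hN hne)) (.inl rfl)
      (.inr ⟨0, by simp [γ]⟩) (.inr ⟨1, by simp [γ]⟩) (.inr ⟨t, rfl⟩)
  obtain ⟨P, hP⟩ := exists_submodule_eq hW C hCcard hC0 hCinj hCaff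
  have hPrank : finrank F P = 2 := by
    have h : Nat.card P = Fintype.card F ^ 2 := by
      rw [← hCcard, ← hP]
      exact Nat.card_coe_set_eq (P : Set (End F W))
    rw [Module.natCard_eq_pow_finrank (K := F), Nat.card_eq_fintype_card] at h
    exact Nat.pow_right_injective hq h
  obtain ⟨K, hK⟩ := exists_subalgebra_eq hW P hPrank (by rwa [← SetLike.mem_coe, hP])
  have hKP : Subalgebra.toSubmodule K = P := SetLike.coe_injective hK
  refine ⟨K, ?_, ?_, ?_⟩
  · rw [← hPrank, ← hKP]
    rfl
  · intro M hM hM0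
    have hM : M ∈ C := by rwa [← hP, ← hK]
    simpa using hCinj 0 hC0 M hM (Ne.symm hM0)
  · rw [hK, hP]
    exact hSC

/-- A regular spread is, in suitable coordinates `W × W`, the set consisting of the vertical line
and of the graphs of the elements of a field of endomorphisms of `W`. -/
theorem IsRegularSpread.exists_subalgebra [Fintype F] {S : Set (Submodule F (Fin 4 → F))}
    (hS : IsRegularSpread (Fintype.card F) S) :
    ∃ (W : Submodule F (Fin 4 → F)) (e : (W × W) ≃ₗ[F] (Fin 4 → F)) (K : Subalgebra F (End F W)),
      finrank F W = 2 ∧ finrank F K = 2 ∧ (∀ M ∈ K, M ≠ 0 → Function.Injective M) ∧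
      S = insert ((verticalLine F W).map (e : (W × W) →ₗ[F] (Fin 4 → F)))
        ((fun M : End F W => M.graph.map (e : (W × W) →ₗ[F] (Fin 4 → F))) '' K) := by
  obtain ⟨hcard, hline, hskew⟩ := hS.1
  have hq : 2 ≤ Fintype.card F := Fintype.one_lt_card
  have hfin : S.Finite := Set.finite_of_ncard_pos (by omega)
  obtain ⟨lv, l₀, l₁, hv, h₀, h₁, hv₀, hv₁, h₀₁⟩ :=
    (Set.two_lt_ncard_iff hfin).1 (by rw [hcard]; nlinarith)
  obtain ⟨e, rfl, he₀, he₁⟩ := exists_coordinates (hline _ h₀) (hline _ h₁) (hline _ hv)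
    (hskew _ h₀ _ h₁ h₀₁) (hskew _ h₀ _ hv hv₀.symm) (hskew _ h₁ _ hv hv₁.symm)
  have hW : finrank F l₀ = 2 := hline _ h₀
  obtain ⟨K, hK⟩ := hS.exists_subalgebra_of_coordinates hW e hv (he₀.symm ▸ h₀) (he₁.symm ▸ h₁)
  exact ⟨l₀, e, K, hW, hK⟩

theorem isDomain_of_forall_injective [Nontrivial W] (K : Subalgebra F (End F W))
    (hK : ∀ M ∈ K, M ≠ 0 → Function.Injective M) : IsDomain K := by
  have : NoZeroDivisors K := by
    refine ⟨fun {a b} hab => ?_⟩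
    by_contra! h
    have ha : (a : End F W) ≠ 0 := by simpa using h.1
    apply h.2
    ext x
    apply hK a a.2 ha
    have := LinearMap.congr_fun (congrArg Subtype.val hab) x
    simpa using this
  exact NoZeroDivisors.to_isDomain K

theorem exists_linearEquiv_apply (hW : finrank F W = 2) {K : Subalgebra F (End F W)}
    (hK : finrank F K = 2) (hinj : ∀ M ∈ K, M ≠ 0 → Function.Injective M) :
    ∃ (v : W) (ε : K ≃ₗ[F] W), ∀ M : K, ε M = (M : End F W) v := by
  have : FiniteDimensional F W := FiniteDimensional.of_finrank_pos (by omega)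
  have : Nontrivial W := Module.nontrivial_of_finrank_pos (R := F) (by omega)
  have : FiniteDimensional F K := FiniteDimensional.of_finrank_pos (by omega)
  obtain ⟨v, hv⟩ := exists_ne (0 : W)
  have hi : Function.Injective (LinearMap.applyₗ v ∘ₗ K.val.toLinearMap) := by
    rw [injective_iff_map_eq_zero]
    intro M hM
    by_contra h0
    exact hv (hinj M M.2 (by simpa using h0) (by simpa using hM))
  exact ⟨v, LinearEquiv.ofInjectiveOfFinrankEq _ hi (hK.trans hW.symm), fun M => rfl⟩

/-- Two-dimensional fields of endomorphisms of two-dimensional spaces over a finite field are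
conjugate under a linear isomorphism between these spaces. -/
theorem exists_linearEquiv_conj [Finite F] {W' : Type*} [AddCommGroup W'] [Module F W']
    (hW : finrank F W = 2) (hW' : finrank F W' = 2)
    {K : Subalgebra F (End F W)} {K' : Subalgebra F (End F W')}
    (hK : finrank F K = 2) (hK' : finrank F K' = 2)
    (hinj : ∀ M ∈ K, M ≠ 0 → Function.Injective M)
    (hinj' : ∀ M ∈ K', M ≠ 0 → Function.Injective M) :
    ∃ (ψ : K ≃ K') (φ : W ≃ₗ[F] W'), ∀ (M : K) (x : W),
      φ ((M : End F W) x) = (ψ M : End F W') (φ x) := by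
  have : Nontrivial W := Module.nontrivial_of_finrank_pos (R := F) (by omega)
  have : Nontrivial W' := Module.nontrivial_of_finrank_pos (R := F) (by omega)
  have := isDomain_of_forall_injective K hinj
  have := isDomain_of_forall_injective K' hinj'
  have : FiniteDimensional F K := FiniteDimensional.of_finrank_pos (by omega)
  have : FiniteDimensional F K' := FiniteDimensional.of_finrank_pos (by omega)
  have : Finite K := Module.finite_of_finite F
  have : Finite K' := Module.finite_of_finite F
  obtain ⟨ψ⟩ := nonempty_algEquiv_of_finrank_eq (hK.trans hK'.symm)
  obtain ⟨v, ε, hε⟩ := exists_linearEquiv_apply hW hK hinj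
  obtain ⟨v', ε', hε'⟩ := exists_linearEquiv_apply hW' hK' hinj'
  refine ⟨ψ, (ε.symm.trans ψ.toLinearEquiv).trans ε', fun M x => ?_⟩
  obtain ⟨N, rfl⟩ := ε.surjective x
  have : (M : End F W) (ε N) = ε (M * N) := by
    rw [hε, hε]
    rfl
  simp [hε', this]

end

/-- Any two regular spreads of PG(3,q) are projectively equivalent: there is an
invertible linear map g of GF(q)^4 carrying the lines of the first spread exactly
onto the lines of the second. -/
theorem regular_spreads_projectively_equivalent (q : ℕ) (F : Type) [Field F] [Fintype F]
    (hq : Fintype.card F = q)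
    (S₁ S₂ : Set (Submodule F (Fin 4 → F)))
    (hS₁ : IsRegularSpread q S₁) (hS₂ : IsRegularSpread q S₂) :
    ∃ g : (Fin 4 → F) ≃ₗ[F] (Fin 4 → F),
      S₂ = (fun l => Submodule.map (g : (Fin 4 → F) →ₗ[F] (Fin 4 → F)) l) '' S₁ := by
  subst hq
  obtain ⟨W, e, K, hW, hK, hinj, rfl⟩ := hS₁.exists_subalgebra
  obtain ⟨W', e', K', hW', hK', hinj', rfl⟩ := hS₂.exists_subalgebra
  obtain ⟨ψ, φ, hφ⟩ := exists_linearEquiv_conj hW hW' hK hK' hinj hinj'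
  let g : (Fin 4 → F) ≃ₗ[F] (Fin 4 → F) := (e.symm.trans (φ.prodCongr φ)).trans e'
  have hg : ∀ x y, g (e (x, y)) = e' (φ x, φ y) := fun x y => by simp [g]
  have hgmap : ∀ (L : Submodule F (W × W)) (L' : Submodule F (W' × W')),
      (∀ x y, (x, y) ∈ L ↔ (φ x, φ y) ∈ L') →
      (L.map (e : (W × W) →ₗ[F] (Fin 4 → F))).map (g : (Fin 4 → F) →ₗ[F] (Fin 4 → F)) =
        L'.map (e' : (W' × W') →ₗ[F] (Fin 4 → F)) := by
    intro L L' h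
    ext v
    constructor
    · rintro ⟨_, ⟨⟨x, y⟩, hxy, rfl⟩, rfl⟩
      exact ⟨_, (h x y).1 hxy, (hg x y).symm⟩
    · rintro ⟨⟨x', y'⟩, hxy, rfl⟩
      obtain ⟨x, rfl⟩ := φ.surjective x'
      obtain ⟨y, rfl⟩ := φ.surjective y'
      exact ⟨_, ⟨_, (h x y).2 hxy, rfl⟩, hg x y⟩
  have hgraph : ∀ M : K, ((M : Module.End F W).graph.map (e : (W × W) →ₗ[F] (Fin 4 → F))).map
      (g : (Fin 4 → F) →ₗ[F] (Fin 4 → F)) =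
      (ψ M : Module.End F W').graph.map (e' : (W' × W') →ₗ[F] (Fin 4 → F)) := fun M =>
    hgmap _ _ fun x y => by simp [LinearMap.mem_graph_iff, ← hφ]
  refine ⟨g, ?_⟩
  rw [Set.image_insert_eq, hgmap _ (verticalLine F W') fun x y => by simp [verticalLine]]
  congr 1
  ext l
  constructor
  · rintro ⟨M', hM', rfl⟩
    obtain ⟨M, hM⟩ := ψ.surjective ⟨M', hM'⟩
    exact ⟨_, ⟨M, M.2, rfl⟩, (hgraph M).trans (by rw [hM])⟩
  · rintro ⟨_, ⟨M, hM, rfl⟩, rfl⟩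
    exact ⟨_, (ψ ⟨M, hM⟩).2, (hgraph ⟨M, hM⟩).symm⟩
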